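/- arXiv:2408.14455 — 4 statements merged into one kernel-verified Lean document; each statement's English description precedes it below -/
import Mathlib

section
/- Let n ≥ 1 and let w = (w_1,…,w_n) be a permutation of {1,…,n}. The chromatic quasisymmetric function of the labeled path P_w is symmetric if and only if w is the identity permutation (w_i = i for all i) or the reversal (w_i = n+1−i for all i). -/
/-- A proper coloring of a labeled graph on vertex set `Fin n` (vertex `v` represents
label `v+1`), with colors in `{1,2,...}`. -/
def properColoring {n : ℕ} (G : SimpleGraph (Fin n)) (c : Fin n → ℕ) : Prop :=
  ∀ u v : Fin n, G.Adj u v → c u ≠ c v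

/-- The ascent number of a coloring: the number of edges `uv` with `u < v` and `c u < c v`. -/
noncomputable def ascNum {n : ℕ} (G : SimpleGraph (Fin n)) (c : Fin n → ℕ) : ℕ :=
  Nat.card {p : Fin n × Fin n // p.1 < p.2 ∧ G.Adj p.1 p.2 ∧ c p.1 < c p.2}

/-- The descent number of a coloring: the number of edges `uv` with `u < v` and `c u > c v`. -/
noncomputable def desNum {n : ℕ} (G : SimpleGraph (Fin n)) (c : Fin n → ℕ) : ℕ :=
  Nat.card {p : Fin n × Fin n // p.1 < p.2 ∧ G.Adj p.1 p.2 ∧ c p.2 < c p.1}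

/-- The coloring `c` uses exactly the colors `1,…,L.length`, color `a` being used
exactly `L.get (a-1)` times. -/
def usesPalette {n : ℕ} (L : List ℕ) (c : Fin n → ℕ) : Prop :=
  (∀ v : Fin n, 1 ≤ c v ∧ c v ≤ L.length) ∧
  ∀ i : Fin L.length, Nat.card {v : Fin n // c v = (i : ℕ) + 1} = L.get i

/-- `NG G L k` is the number of proper colorings of `G` with ascent number `k`
and palette `L`. -/
noncomputable def NG {n : ℕ} (G : SimpleGraph (Fin n)) (L : List ℕ) (k : ℕ) : ℕ :=
  Nat.card {c : Fin n → ℕ // properColoring G c ∧ usesPalette L c ∧ ascNum G c = k}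

/-- `L` is a composition of `n`: a list of positive integers summing to `n`. -/
def IsComposition (n : ℕ) (L : List ℕ) : Prop :=
  (∀ a ∈ L, 0 < a) ∧ L.sum = n

/-- The chromatic quasisymmetric function of `G` is symmetric. -/
def cqfSymmetric {n : ℕ} (G : SimpleGraph (Fin n)) : Prop :=
  ∀ L M : List ℕ, IsComposition n L → IsComposition n M → List.Perm L M →
    ∀ k : ℕ, NG G L k = NG G M k

/-- The number of edges of `G`. -/
noncomputable def edgeCount {n : ℕ} (G : SimpleGraph (Fin n)) : ℕ := Nat.card G.edgeSet

/-- The chromatic quasisymmetric function of `G` is palindromic. -/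
def cqfPalindromic {n : ℕ} (G : SimpleGraph (Fin n)) : Prop :=
  ∀ L : List ℕ, IsComposition n L →
    ∀ k : ℕ, k ≤ edgeCount G → NG G L k = NG G L (edgeCount G - k)

/-- The labeled path `P_w` of a permutation `w` of `Fin n`: edges `{w i, w (i+1)}`. -/
def pathGraph {n : ℕ} (w : Equiv.Perm (Fin n)) : SimpleGraph (Fin n) :=
  SimpleGraph.fromRel (fun u v => ∃ i : ℕ, ∃ h : i + 1 < n,
    u = w ⟨i, by omega⟩ ∧ v = w ⟨i + 1, h⟩)

/-- The flipped labeled graph: `uv` is an edge iff `(n+1-u)(n+1-v)` is an edge of `G`. -/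
def flipGraph {n : ℕ} (G : SimpleGraph (Fin n)) : SimpleGraph (Fin n) :=
  SimpleGraph.comap Fin.rev G

/-- The ascent-descent pattern of `w`, where `true` records an ascent (`a`) and
`false` records a descent (`d`). -/
def adPattern {n : ℕ} (w : Equiv.Perm (Fin n)) : List Bool :=
  List.ofFn (fun i : Fin (n - 1) =>
    decide (w ⟨(i : ℕ), by have := i.isLt; omega⟩ < w ⟨(i : ℕ) + 1, by have := i.isLt; omega⟩))

/-- The ribbon word `a^{α₁-1} d a^{α₂-1} d ⋯ d a^{α_ℓ-1}` of a composition. -/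
def ribbonWord : List ℕ → List Bool
  | [] => []
  | [a] => List.replicate (a - 1) true
  | a :: b :: rest => List.replicate (a - 1) true ++ false :: ribbonWord (b :: rest)

/-- Position `i` is a local minimum of `w`. -/
def LocalMinAt {n : ℕ} (w : Equiv.Perm (Fin n)) (i : Fin n) : Prop :=
  (∀ _ : 0 < (i : ℕ), w i < w ⟨(i : ℕ) - 1, by have := i.isLt; omega⟩) ∧
  (∀ h : (i : ℕ) + 1 < n, w i < w ⟨(i : ℕ) + 1, h⟩)

/-- Position `i` is a local maximum of `w`. -/
def LocalMaxAt {n : ℕ} (w : Equiv.Perm (Fin n)) (i : Fin n) : Prop :=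
  (∀ _ : 0 < (i : ℕ), w ⟨(i : ℕ) - 1, by have := i.isLt; omega⟩ < w i) ∧
  (∀ h : (i : ℕ) + 1 < n, w ⟨(i : ℕ) + 1, h⟩ < w i)

/-- The labeled star `K_{1,n-1}` with central vertex `j`. -/
def starGraph (n : ℕ) (j : Fin n) : SimpleGraph (Fin n) :=
  SimpleGraph.fromRel (fun u v => u = j ∧ v ≠ j)

section

open Finset

/-- Weight of a pair of consecutive letters: `w.1` at an ascent, `w.2.1` at a descent and
`w.2.2` at a plateau. -/
def pairWeight {κ R : Type*} [LinearOrder κ] (w : R × R × R) (c d : κ) : R :=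
  if c < d then w.1 else if d < c then w.2.1 else w.2.2

/-- Generating function of the words of length `N + 1` with first letter `c`. -/
def transfer {κ R : Type*} [LinearOrder κ] [Fintype κ] [CommRing R] (x : κ → R) :
    (N : ℕ) → (Fin N → R × R × R) → κ → R
  | 0, _, c => x c
  | N + 1, ws, c => x c * ∑ d, pairWeight (ws 0) c d * transfer x N (fun i => ws i.succ) d

theorem sum_eq_add_add_sum_erase {κ R : Type*} [DecidableEq κ] [Fintype κ] [CommRing R]
    {a b : κ} (hab : a ≠ b) (g : κ → R) :
    ∑ d, g d = g a + g b + ∑ d ∈ (univ.erase a).erase b, g d := by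
  rw [← Finset.add_sum_erase univ g (mem_univ a),
    ← Finset.add_sum_erase (univ.erase a) g (mem_erase.2 ⟨hab.symm, mem_univ b⟩), add_assoc]

theorem transfer_swap {κ R : Type*} [LinearOrder κ] [Fintype κ] [CommRing R]
    {a b : κ} (hab : a < b) (hadj : ∀ c, c ≠ a → c ≠ b → (c < a ↔ c < b))
    {x y : κ → R} (ha : y a = x b) (hb : y b = x a) (hxy : ∀ c, c ≠ a → c ≠ b → y c = x c)
    (N : ℕ) (ws : Fin N → R × R × R)
    (hws : ∀ i j : Fin N, (i : ℕ) + 1 = j →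
      ((ws i).1 - (ws i).2.2) * ((ws j).2.1 - (ws j).2.2) =
      ((ws i).2.1 - (ws i).2.2) * ((ws j).1 - (ws j).2.2)) :
    (∀ c, c ≠ a → c ≠ b → transfer y N ws c = transfer x N ws c) ∧
    transfer y N ws a + transfer y N ws b = transfer x N ws a + transfer x N ws b ∧
    ∀ α β : R, (∀ j : Fin N, (j : ℕ) = 0 →
        α * ((ws j).2.1 - (ws j).2.2) = β * ((ws j).1 - (ws j).2.2)) →
      y a * α * transfer y N ws b + y b * β * transfer y N ws a =
      x a * α * transfer x N ws b + x b * β * transfer x N ws a := by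
  induction N with
  | zero =>
    refine ⟨fun c h1 h2 => by simp [transfer, hxy c h1 h2], by simp [transfer, ha, hb, add_comm],
      fun α β _ => ?_⟩
    simp only [transfer, ha, hb]
    ring
  | succ N ih =>
    obtain ⟨ih1, ih2, ih3⟩ := ih (fun i => ws i.succ) (fun i j hij => hws _ _ (by simp [← hij]))
    have hba : ¬ b < a := hab.not_gt
    have hpa : ∀ c, c ≠ a → c ≠ b → ∀ w : R × R × R, pairWeight w c b = pairWeight w c a := by
      intro c h1 h2 w
      have h3 := hadj c h1 h2
      rcases lt_or_gt_of_ne h1 with h | h <;> rcases lt_or_gt_of_ne h2 with h' | h' <;>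
        simp_all [pairWeight, not_lt_of_gt]
    have hpb : ∀ c, c ≠ a → c ≠ b → ∀ w : R × R × R, pairWeight w b c = pairWeight w a c := by
      intro c h1 h2 w
      have h3 := hadj c h1 h2
      rcases lt_or_gt_of_ne h1 with h | h <;> rcases lt_or_gt_of_ne h2 with h' | h' <;>
        simp_all [pairWeight, not_lt_of_gt]
    set Tx := transfer x N (fun i => ws i.succ) with hTx
    set Ty := transfer y N (fun i => ws i.succ) with hTy
    have hmem : ∀ d ∈ (univ.erase a).erase b, d ≠ a ∧ d ≠ b := by
      intro d hd; simp at hd; tauto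
    obtain ⟨Q, hQ⟩ : ∃ Q, Q = ∑ d ∈ (univ.erase a).erase b, pairWeight (ws 0) a d * Tx d := ⟨_, rfl⟩
    have hxa : transfer x (N + 1) ws a =
        x a * ((ws 0).2.2 * Tx a + (ws 0).1 * Tx b + Q) := by
      rw [transfer, sum_eq_add_add_sum_erase hab.ne, hQ]
      simp [pairWeight, hab, hTx]
    have hxb : transfer x (N + 1) ws b =
        x b * ((ws 0).2.1 * Tx a + (ws 0).2.2 * Tx b + Q) := by
      rw [transfer, sum_eq_add_add_sum_erase hab.ne, hQ,
        Finset.sum_congr rfl fun d hd => by rw [hpb d (hmem d hd).1 (hmem d hd).2]]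
      simp [pairWeight, hab, hba, hTx]
    have hya : transfer y (N + 1) ws a =
        y a * ((ws 0).2.2 * Ty a + (ws 0).1 * Ty b + Q) := by
      rw [transfer, sum_eq_add_add_sum_erase hab.ne, hQ,
        Finset.sum_congr rfl fun d hd => by rw [← hTy, ih1 d (hmem d hd).1 (hmem d hd).2]]
      simp [pairWeight, hab, hTy]
    have hyb : transfer y (N + 1) ws b =
        y b * ((ws 0).2.1 * Ty a + (ws 0).2.2 * Ty b + Q) := by
      rw [transfer, sum_eq_add_add_sum_erase hab.ne, hQ,
        Finset.sum_congr rfl fun d hd => by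
          rw [hpb d (hmem d hd).1 (hmem d hd).2, ← hTy, ih1 d (hmem d hd).1 (hmem d hd).2]]
      simp [pairWeight, hab, hba, hTy]
    refine ⟨fun c h1 h2 => ?_, ?_, fun α β h => ?_⟩
    · rw [transfer, transfer, hxy c h1 h2, sum_eq_add_add_sum_erase hab.ne,
        sum_eq_add_add_sum_erase hab.ne, ← hTx, ← hTy, hpa c h1 h2,
        Finset.sum_congr rfl fun d hd => by rw [ih1 d (hmem d hd).1 (hmem d hd).2],
        ← mul_add, ← mul_add, ih2]
    · have h3 := ih3 ((ws 0).1 - (ws 0).2.2) ((ws 0).2.1 - (ws 0).2.2)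
        (fun j hj => hws 0 j.succ (by simp [hj]))
      rw [hxa, hxb, hya, hyb]
      rw [ha, hb] at *
      linear_combination h3 + (x a + x b) * (ws 0).2.2 * ih2
    · have h0 := h 0 rfl
      rw [hxa, hxb, hya, hyb, ha, hb]
      linear_combination (x a * x b) * ((α + β) * (ws 0).2.2 + α * ((ws 0).2.1 - (ws 0).2.2)) * ih2
        - x a * x b * (Ty b - Tx b) * h0

theorem transfer_eq_sum {κ R : Type*} [LinearOrder κ] [Fintype κ] [CommRing R] (x : κ → R)
    (N : ℕ) (ws : Fin N → R × R × R) (c : κ) :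
    transfer x N ws c = ∑ d : Fin N → κ, (∏ i, x ((Fin.cons c d : Fin (N + 1) → κ) i)) *
      ∏ i : Fin N, pairWeight (ws i) ((Fin.cons c d : Fin (N + 1) → κ) i.castSucc)
        ((Fin.cons c d : Fin (N + 1) → κ) i.succ) := by
  induction N generalizing c with
  | zero => simp [transfer]
  | succ N ih =>
    rw [transfer, ← (Fin.consEquiv fun _ => κ).sum_comp, Fintype.sum_prod_type, Finset.mul_sum]
    refine Finset.sum_congr rfl fun d _ => ?_
    rw [ih, Finset.mul_sum, Finset.mul_sum]
    refine Finset.sum_congr rfl fun f _ => ?_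
    have hc : (Fin.consEquiv fun _ : Fin (N + 1) => κ) (d, f) = Fin.cons d f := rfl
    rw [hc]
    have h1 : ∏ i, x ((Fin.cons c (Fin.cons d f) : Fin (N + 1 + 1) → κ) i) =
        x c * ∏ i, x ((Fin.cons d f : Fin (N + 1) → κ) i) := by
      rw [Fin.prod_univ_succ]
      rfl
    have h2 : ∏ i : Fin (N + 1),
        pairWeight (ws i) ((Fin.cons c (Fin.cons d f) : Fin (N + 1 + 1) → κ) i.castSucc)
          ((Fin.cons c (Fin.cons d f) : Fin (N + 1 + 1) → κ) i.succ) =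
        pairWeight (ws 0) c d * ∏ i : Fin N,
          pairWeight (ws i.succ) ((Fin.cons d f : Fin (N + 1) → κ) i.castSucc)
            ((Fin.cons d f : Fin (N + 1) → κ) i.succ) := by
      rw [Fin.prod_univ_succ]
      rfl
    rw [h1, h2]
    ring

theorem sum_transfer {κ R : Type*} [LinearOrder κ] [Fintype κ] [CommRing R] (x : κ → R)
    (N : ℕ) (ws : Fin N → R × R × R) :
    ∑ c, transfer x N ws c = ∑ d : Fin (N + 1) → κ, (∏ i, x (d i)) *
      ∏ i : Fin N, pairWeight (ws i) (d i.castSucc) (d i.succ) := by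
  rw [← (Fin.consEquiv fun _ => κ).sum_comp, Fintype.sum_prod_type]
  exact Finset.sum_congr rfl fun c _ => transfer_eq_sum x N ws c

/-- The number of occurrences of each letter in the word `d`. -/
def content {n ℓ : ℕ} (d : Fin n → Fin ℓ) (a : Fin ℓ) : ℕ := #{i | d i = a}

/-- Product of the weights of all pairs of consecutive letters of `d`. -/
def wordWeight {N ℓ : ℕ} {A : Type*} [CommRing A] (ws : Fin N → A × A × A)
    (d : Fin (N + 1) → Fin ℓ) : A :=
  ∏ i : Fin N, pairWeight (ws i) (d i.castSucc) (d i.succ)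

theorem content_comp_perm {n ℓ : ℕ} (σ : Equiv.Perm (Fin ℓ)) (d : Fin n → Fin ℓ) :
    content (fun i => σ (d i)) = content d ∘ σ.symm := by
  ext a
  simp [content, Equiv.eq_symm_apply]

theorem prod_X_eq_monomial_content {n ℓ : ℕ} {A : Type*} [CommRing A] (d : Fin n → Fin ℓ) :
    ∏ i, (MvPolynomial.X (d i) : MvPolynomial (Fin ℓ) A) =
      MvPolynomial.monomial (Finsupp.equivFunOnFinite.symm (content d)) 1 := by
  have h : Finsupp.equivFunOnFinite.symm (content d) = ∑ i, Finsupp.single (d i) 1 := by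
    ext a
    simp [content, Finsupp.finsetSum_apply, Finsupp.single_apply]
  rw [h, MvPolynomial.monomial_sum_one]
  rfl

theorem coeff_sum_transfer {N ℓ : ℕ} {A : Type*} [CommRing A] (ws : Fin N → A × A × A)
    (σ : Equiv.Perm (Fin ℓ)) (m : Fin ℓ → ℕ) :
    MvPolynomial.coeff (Finsupp.equivFunOnFinite.symm m)
      (∑ c, transfer (fun a => (MvPolynomial.X (σ a) : MvPolynomial (Fin ℓ) A)) N
        (fun i => (MvPolynomial.C (ws i).1, MvPolynomial.C (ws i).2.1,
          MvPolynomial.C (ws i).2.2)) c) =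
      ∑ d : Fin (N + 1) → Fin ℓ with content d = m ∘ σ, wordWeight ws d := by
  rw [sum_transfer, MvPolynomial.coeff_sum, Finset.sum_filter]
  refine Finset.sum_congr rfl fun d _ => ?_
  have h1 : (∏ i : Fin N, pairWeight ((MvPolynomial.C (ws i).1, MvPolynomial.C (ws i).2.1,
      MvPolynomial.C (ws i).2.2) : MvPolynomial (Fin ℓ) A × MvPolynomial (Fin ℓ) A ×
        MvPolynomial (Fin ℓ) A) (d i.castSucc) (d i.succ)) = MvPolynomial.C (wordWeight ws d) := by
    rw [wordWeight, map_prod]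
    refine Finset.prod_congr rfl fun i _ => ?_
    simp only [pairWeight]
    split_ifs <;> rfl
  rw [h1, prod_X_eq_monomial_content (fun i => σ (d i)), mul_comm, MvPolynomial.coeff_C_mul,
    MvPolynomial.coeff_monomial, content_comp_perm]
  have h2 : Finsupp.equivFunOnFinite.symm (content d ∘ σ.symm) =
      Finsupp.equivFunOnFinite.symm m ↔ content d = m ∘ σ := by
    rw [Equiv.apply_eq_iff_eq, Equiv.comp_symm_eq]
  simp only [h2, mul_ite, mul_one, mul_zero]

theorem sum_wordWeight_comp_perm {N ℓ : ℕ} {A : Type*} [CommRing A] (ws : Fin N → A × A × A)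
    (hws : ∀ i j : Fin N, (i : ℕ) + 1 = j →
      ((ws i).1 - (ws i).2.2) * ((ws j).2.1 - (ws j).2.2) =
      ((ws i).2.1 - (ws i).2.2) * ((ws j).1 - (ws j).2.2))
    (σ : Equiv.Perm (Fin ℓ)) (m : Fin ℓ → ℕ) :
    ∑ d : Fin (N + 1) → Fin ℓ with content d = m ∘ σ, wordWeight ws d =
      ∑ d : Fin (N + 1) → Fin ℓ with content d = m, wordWeight ws d := by
  cases ℓ with
  | zero => rw [Subsingleton.elim (m ∘ σ) m]
  | succ ℓ =>
    have hσ : σ ∈ Submonoid.closure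
        (Set.range fun i : Fin ℓ => Equiv.swap i.castSucc i.succ) := by
      rw [Equiv.Perm.mclosure_swap_castSucc_succ]
      trivial
    induction hσ using Submonoid.closure_induction generalizing m with
    | one => rfl
    | mul σ τ _ _ h1 h2 =>
      rw [← h1 m, ← h2 (m ∘ σ)]
      rfl
    | mem σ hσ =>
      obtain ⟨i, rfl⟩ := hσ
      have h0 := coeff_sum_transfer ws (1 : Equiv.Perm (Fin (ℓ + 1))) m
      rw [← coeff_sum_transfer ws (Equiv.swap i.castSucc i.succ) m]
      rw [show m ∘ (1 : Equiv.Perm (Fin (ℓ + 1))) = m from rfl] at h0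
      rw [← h0]
      have hab : i.castSucc < i.succ := Fin.castSucc_lt_succ
      obtain ⟨h1, h2, -⟩ := transfer_swap hab
        (x := fun a => (MvPolynomial.X ((1 : Equiv.Perm (Fin (ℓ + 1))) a) :
          MvPolynomial (Fin (ℓ + 1)) A))
        (y := fun a => (MvPolynomial.X (Equiv.swap i.castSucc i.succ a) :
          MvPolynomial (Fin (ℓ + 1)) A))
        (fun c h1 h2 => by
          simp only [Fin.lt_def, ne_eq, Fin.ext_iff, Fin.val_castSucc, Fin.val_succ] at *
          omega)
        (by simp) (by simp) (fun c h1 h2 => by simp [Equiv.swap_apply_of_ne_of_ne h1 h2]) N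
        (fun i => (MvPolynomial.C (ws i).1, MvPolynomial.C (ws i).2.1,
          MvPolynomial.C (ws i).2.2))
        (fun i j hij => by
          simp only [← MvPolynomial.C_sub, ← MvPolynomial.C_mul, hws i j hij])
      congr 1
      rw [sum_eq_add_add_sum_erase hab.ne, sum_eq_add_add_sum_erase hab.ne, h2]
      congr 1
      refine Finset.sum_congr rfl fun c hc => ?_
      simp only [mem_erase, mem_univ, and_true] at hc
      exact h1 c hc.2 hc.1

theorem pathGraph_adj {N : ℕ} (w : Equiv.Perm (Fin (N + 1))) (u v : Fin (N + 1)) :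
    (pathGraph w).Adj u v ↔ ∃ i : Fin N, (u = w i.castSucc ∧ v = w i.succ) ∨
      (v = w i.castSucc ∧ u = w i.succ) := by
  rw [pathGraph, SimpleGraph.fromRel_adj]
  constructor
  · rintro ⟨-, ⟨i, hi, h1, h2⟩ | ⟨i, hi, h1, h2⟩⟩
    · exact ⟨⟨i, by omega⟩, Or.inl ⟨h1, h2⟩⟩
    · exact ⟨⟨i, by omega⟩, Or.inr ⟨h1, h2⟩⟩
  · rintro ⟨i, ⟨rfl, rfl⟩ | ⟨rfl, rfl⟩⟩
    · exact ⟨fun h => absurd (w.injective h) Fin.castSucc_lt_succ.ne,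
        Or.inl ⟨i, by omega, rfl, rfl⟩⟩
    · exact ⟨fun h => absurd (w.injective h) Fin.castSucc_lt_succ.ne',
        Or.inr ⟨i, by omega, rfl, rfl⟩⟩

theorem properColoring_pathGraph {N : ℕ} (w : Equiv.Perm (Fin (N + 1))) (c : Fin (N + 1) → ℕ) :
    properColoring (pathGraph w) c ↔ ∀ i : Fin N, c (w i.castSucc) ≠ c (w i.succ) := by
  simp only [properColoring, pathGraph_adj]
  constructor
  · exact fun h i => h _ _ ⟨i, Or.inl ⟨rfl, rfl⟩⟩
  · rintro h u v ⟨i, ⟨rfl, rfl⟩ | ⟨rfl, rfl⟩⟩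
    exacts [h i, (h i).symm]

theorem ascNum_pathGraph {N : ℕ} (w : Equiv.Perm (Fin (N + 1))) (c : Fin (N + 1) → ℕ)
    (hc : ∀ i : Fin N, c (w i.castSucc) ≠ c (w i.succ)) :
    ascNum (pathGraph w) c = #{i : Fin N | w i.castSucc < w i.succ ↔
      c (w i.castSucc) < c (w i.succ)} := by
  have hw : ∀ i : Fin N, w i.castSucc ≠ w i.succ := fun i h =>
    Fin.castSucc_lt_succ.ne (w.injective h)
  rw [ascNum, ← Fintype.card_subtype, ← Nat.card_eq_fintype_card]
  symm
  refine Nat.card_eq_of_bijective (fun i => if h : w i.1.castSucc < w i.1.succ then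
    ⟨(w i.1.castSucc, w i.1.succ), h, (pathGraph_adj _ _ _).2 ⟨i.1, Or.inl ⟨rfl, rfl⟩⟩, i.2.1 h⟩
    else ⟨(w i.1.succ, w i.1.castSucc), lt_of_le_of_ne (not_lt.1 h) (hw _).symm,
      (pathGraph_adj _ _ _).2 ⟨i.1, Or.inr ⟨rfl, rfl⟩⟩,
      lt_of_le_of_ne (not_lt.1 fun h' => h (i.2.2 h')) (hc _).symm⟩) ⟨?_, ?_⟩
  · rintro ⟨i, hi⟩ ⟨j, hj⟩ hij
    have h1 : (w i.castSucc = w j.castSucc) ∨ (w i.castSucc = w j.succ ∧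
        w i.succ = w j.castSucc) := by
      dsimp only at hij
      split_ifs at hij <;> simp only [Subtype.mk.injEq, Prod.mk.injEq] at hij <;> tauto
    simp only [EmbeddingLike.apply_eq_iff_eq, Fin.ext_iff, Fin.val_castSucc, Fin.val_succ] at h1
    rw [Subtype.mk.injEq, Fin.ext_iff]
    omega
  · rintro ⟨⟨u, v⟩, huv, hadj, hcuv⟩
    dsimp only at huv hadj hcuv
    obtain ⟨i, ⟨rfl, rfl⟩ | ⟨rfl, rfl⟩⟩ := (pathGraph_adj _ _ _).1 hadj
    · refine ⟨⟨i, iff_of_true huv hcuv⟩, ?_⟩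
      simp [huv]
    · refine ⟨⟨i, iff_of_false huv.not_gt hcuv.not_gt⟩, ?_⟩
      simp [huv.not_gt]

theorem usesPalette_ofFn {n ℓ : ℕ} (w : Equiv.Perm (Fin n)) (m : Fin ℓ → ℕ)
    (f : Fin n → Fin ℓ) :
    usesPalette (List.ofFn m) (fun v => (f (w.symm v) : ℕ) + 1) ↔ content f = m := by
  have hcard : ∀ a : Fin ℓ, Nat.card {v : Fin n // (f (w.symm v) : ℕ) + 1 = (a : ℕ) + 1} =
      content f a := by
    intro a
    rw [content, ← Fintype.card_subtype, ← Nat.card_eq_fintype_card]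
    exact Nat.card_congr (w.symm.subtypeEquiv fun v => by simp [Fin.ext_iff])
  constructor
  · rintro ⟨-, h⟩
    ext a
    have := h (Fin.cast List.length_ofFn.symm a)
    rw [← hcard a]
    simpa using this
  · rintro rfl
    refine ⟨fun v => ⟨Nat.le_add_left _ _, ?_⟩, fun i => ?_⟩
    · rw [List.length_ofFn]
      exact (f (w.symm v)).isLt
    · rw [List.get_ofFn]
      exact hcard (Fin.cast List.length_ofFn i)

theorem NG_pathGraph {N ℓ : ℕ} (w : Equiv.Perm (Fin (N + 1))) (m : Fin ℓ → ℕ) (k : ℕ) :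
    NG (pathGraph w) (List.ofFn m) k = #{f : Fin (N + 1) → Fin ℓ | content f = m ∧
      (∀ i : Fin N, f i.castSucc ≠ f i.succ) ∧
      #{i : Fin N | w i.castSucc < w i.succ ↔ f i.castSucc < f i.succ} = k} := by
  have key : ∀ f : Fin (N + 1) → Fin ℓ,
      (properColoring (pathGraph w) (fun v => (f (w.symm v) : ℕ) + 1) ∧
        usesPalette (List.ofFn m) (fun v => (f (w.symm v) : ℕ) + 1) ∧
        ascNum (pathGraph w) (fun v => (f (w.symm v) : ℕ) + 1) = k) ↔
      (content f = m ∧ (∀ i : Fin N, f i.castSucc ≠ f i.succ) ∧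
        #{i : Fin N | w i.castSucc < w i.succ ↔ f i.castSucc < f i.succ} = k) := by
    intro f
    rw [usesPalette_ofFn, properColoring_pathGraph]
    by_cases h : ∀ i : Fin N, f i.castSucc ≠ f i.succ
    · rw [ascNum_pathGraph w _ (by simpa [Fin.ext_iff] using h)]
      simp only [Equiv.symm_apply_apply, Nat.add_right_cancel_iff, Fin.val_inj,
        Nat.add_lt_add_iff_right, Fin.val_fin_lt, ne_eq]
      tauto
    · simp only [Equiv.symm_apply_apply, ne_eq, Nat.add_right_cancel_iff, Fin.val_inj] at h ⊢
      tauto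
  rw [NG, ← Fintype.card_subtype, ← Nat.card_eq_fintype_card]
  symm
  refine Nat.card_eq_of_bijective
    (fun f => ⟨fun v => (f.1 (w.symm v) : ℕ) + 1, (key f.1).2 f.2⟩) ⟨?_, ?_⟩
  · rintro ⟨f, hf⟩ ⟨g, hg⟩ hfg
    simp only [Subtype.mk.injEq] at hfg ⊢
    ext i
    simpa using congrFun hfg (w i)
  · rintro ⟨c, hc⟩
    have hb := hc.2.1.1
    rw [List.length_ofFn] at hb
    obtain ⟨f, rfl⟩ : ∃ f : Fin (N + 1) → Fin ℓ, (fun v => (f (w.symm v) : ℕ) + 1) = c :=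
      ⟨fun i => ⟨c (w i) - 1, by have := hb (w i); omega⟩, by
        ext v
        have := hb v
        simp only [Equiv.apply_symm_apply]
        omega⟩
    exact ⟨⟨f, (key f).1 hc⟩, rfl⟩

theorem exists_ofFn_eq_of_perm {L M : List ℕ} (h : L.Perm M) :
    ∃ (ℓ : ℕ) (m : Fin ℓ → ℕ) (σ : Equiv.Perm (Fin ℓ)),
      L = List.ofFn m ∧ M = List.ofFn (m ∘ σ) := by
  obtain ⟨ℓ, m, m', rfl, rfl⟩ : ∃ (ℓ : ℕ) (m m' : Fin ℓ → ℕ),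
      L = List.ofFn m ∧ M = List.ofFn m' := by
    refine ⟨L.length, L.get, fun i => M.get (Fin.cast h.length_eq i), (List.ofFn_get L).symm, ?_⟩
    refine List.ext_get (by simp [h.length_eq]) fun i h1 h2 => by simp
  have hsort : m ∘ Tuple.sort m = m' ∘ Tuple.sort m' := by
    refine List.ofFn_injective (List.Perm.eq_of_sortedLE
      (List.sortedLE_ofFn_iff.2 (Tuple.monotone_sort m))
      (List.sortedLE_ofFn_iff.2 (Tuple.monotone_sort m')) ?_)
    exact ((Tuple.sort m).ofFn_comp_perm m).trans
      (h.trans ((Tuple.sort m').ofFn_comp_perm m').symm)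
  refine ⟨ℓ, m, Tuple.sort m * (Tuple.sort m')⁻¹, rfl, congrArg _ ?_⟩
  ext i
  simpa using (congrFun hsort ((Tuple.sort m').symm i)).symm

theorem cqfSymmetric_pathGraph_of_lt_iff {N : ℕ} (w : Equiv.Perm (Fin (N + 1))) (s : Prop)
    (hs : ∀ i : Fin N, w i.castSucc < w i.succ ↔ s) : cqfSymmetric (pathGraph w) := by
  classical
  rintro L M - - hLM k
  obtain ⟨ℓ, m, σ, rfl, rfl⟩ := exists_ofFn_eq_of_perm hLM
  have key := congrArg (fun p : Polynomial ℤ => p.coeff k) (sum_wordWeight_comp_perm (N := N)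
    (fun _ => ((if s then Polynomial.X else 1 : Polynomial ℤ),
      (if s then 1 else Polynomial.X : Polynomial ℤ), (0 : Polynomial ℤ)))
    (fun _ _ _ => by simp [mul_comm]) σ m)
  have hw : ∀ d : Fin (N + 1) → Fin ℓ, (wordWeight
      (fun _ => ((if s then Polynomial.X else 1 : Polynomial ℤ),
        (if s then 1 else Polynomial.X : Polynomial ℤ), (0 : Polynomial ℤ))) d).coeff k =
      if (∀ i : Fin N, d i.castSucc ≠ d i.succ) ∧
        #{i : Fin N | w i.castSucc < w i.succ ↔ d i.castSucc < d i.succ} = k then 1 else 0 := by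
    intro d
    by_cases hd : ∀ i : Fin N, d i.castSucc ≠ d i.succ
    · have h1 : wordWeight (fun _ => ((if s then Polynomial.X else 1 : Polynomial ℤ),
          (if s then 1 else Polynomial.X : Polynomial ℤ), (0 : Polynomial ℤ))) d =
          Polynomial.X ^ #{i : Fin N | w i.castSucc < w i.succ ↔ d i.castSucc < d i.succ} := by
        rw [wordWeight, ← Finset.prod_const, Finset.prod_filter]
        refine Finset.prod_congr rfl fun i _ => ?_
        rcases lt_or_gt_of_ne (hd i) with h' | h' <;> by_cases hs' : s <;>
          simp [pairWeight, h', h'.not_gt, hs, hs']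
      rw [h1, Polynomial.coeff_X_pow]
      exact if_congr (by rw [eq_comm]; exact (and_iff_right hd).symm) rfl rfl
    · refine Eq.trans ?_ (if_neg fun hp => hd hp.1).symm
      obtain ⟨i, hi⟩ := not_forall_not.1 hd
      rw [wordWeight, Finset.prod_eq_zero (mem_univ i) (by simp [pairWeight, hi])]
      simp
  simp only [Polynomial.finsetSum_coeff, hw, Finset.sum_boole, Finset.filter_filter] at key
  rw [NG_pathGraph, NG_pathGraph]
  exact_mod_cast key.symm

/-- The word `d` increases strictly at the positions in `S` and decreases strictly at the
others. -/
def IsStrict {κ : Type*} [LT κ] {N : ℕ} (S : ℕ → Prop) (d : Fin (N + 1) → κ) : Prop :=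
  ∀ i : Fin N, (S i → d i.castSucc < d i.succ) ∧ (¬ S i → d i.succ < d i.castSucc)

/-- The word `d` increases weakly at the positions in `S` and decreases strictly at the
others. -/
def IsWeak {κ : Type*} [LT κ] [LE κ] {N : ℕ} (S : ℕ → Prop) (d : Fin (N + 1) → κ) : Prop :=
  ∀ i : Fin N, (S i → d i.castSucc ≤ d i.succ) ∧ (¬ S i → d i.succ < d i.castSucc)

open Classical in
/-- The number of strict words of given content is invariant under permutations of the letters. -/
def StrictSymmetric (N : ℕ) (S : ℕ → Prop) : Prop :=
  ∀ (ℓ : ℕ) (d : Fin (N + 1) → Fin ℓ), Function.Surjective d → ∀ σ : Equiv.Perm (Fin ℓ),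
    #{f : Fin (N + 1) → Fin ℓ | content f = content d ∧ IsStrict S f} =
      #{f : Fin (N + 1) → Fin ℓ | content f = content d ∘ σ ∧ IsStrict S f}

theorem content_pos {n ℓ : ℕ} {d : Fin n → Fin ℓ} (hd : Function.Surjective d) (a : Fin ℓ) :
    0 < content d a := by
  obtain ⟨v, rfl⟩ := hd a
  exact Finset.card_pos.2 ⟨v, by simp⟩

theorem sum_content {n ℓ : ℕ} (d : Fin n → Fin ℓ) : ∑ a, content d a = n := by
  simpa [content] using
    (Finset.card_eq_sum_card_fiberwise (f := d) (s := univ) (t := univ) (by simp)).symm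

theorem NG_eq_of_cqfSymmetric {n ℓ : ℕ} {G : SimpleGraph (Fin n)} (hG : cqfSymmetric G)
    {d : Fin n → Fin ℓ} (hd : Function.Surjective d) (σ : Equiv.Perm (Fin ℓ)) (k : ℕ) :
    NG G (List.ofFn (content d)) k = NG G (List.ofFn (content d ∘ σ)) k := by
  refine hG _ _ ⟨?_, ?_⟩ ⟨?_, ?_⟩ (σ.ofFn_comp_perm _).symm k
  · simpa [List.mem_ofFn] using content_pos hd
  · rw [List.sum_ofFn, sum_content]
  · simpa [List.mem_ofFn] using fun a => content_pos hd (σ a)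
  · rw [List.sum_ofFn]
    exact (Equiv.sum_comp σ (content d)).trans (sum_content d)

theorem strictSymmetric_of_cqfSymmetric {N : ℕ} {w : Equiv.Perm (Fin (N + 1))}
    (h : cqfSymmetric (pathGraph w)) {S : ℕ → Prop}
    (hS : ∀ i : Fin N, S i ↔ w i.castSucc < w i.succ) : StrictSymmetric N S := by
  classical
  intro ℓ d hd σ
  have key := NG_eq_of_cqfSymmetric h hd σ N
  rw [NG_pathGraph, NG_pathGraph] at key
  have hstrict : ∀ f : Fin (N + 1) → Fin ℓ, ((∀ i : Fin N, f i.castSucc ≠ f i.succ) ∧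
      #{i : Fin N | w i.castSucc < w i.succ ↔ f i.castSucc < f i.succ} = N) ↔ IsStrict S f := by
    intro f
    have hN : #{i : Fin N | w i.castSucc < w i.succ ↔ f i.castSucc < f i.succ} = N ↔
        ∀ i : Fin N, (w i.castSucc < w i.succ ↔ f i.castSucc < f i.succ) := by
      simpa using Finset.card_filter_eq_iff (s := (univ : Finset (Fin N)))
        (p := fun i => w i.castSucc < w i.succ ↔ f i.castSucc < f i.succ)
    rw [hN, ← forall_and]
    refine forall_congr' fun i => ?_
    rw [hS]
    rcases lt_trichotomy (f i.castSucc) (f i.succ) with h | h | h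
    · simp [h, h.ne, h.not_gt]
    · simp [h]
    · simp [h, h.ne', h.not_gt]
  exact (congrArg card (filter_congr fun f _ => and_congr_right fun _ => (hstrict f).symm)).trans
    (key.trans (congrArg card (filter_congr fun f _ => and_congr_right fun _ => hstrict f)))

theorem strictSymmetric_not_of_cqfSymmetric {N : ℕ} {w : Equiv.Perm (Fin (N + 1))}
    (h : cqfSymmetric (pathGraph w)) {S : ℕ → Prop}
    (hS : ∀ i : Fin N, S i ↔ ¬ w i.castSucc < w i.succ) : StrictSymmetric N S := by
  classical
  intro ℓ d hd σ
  have key := NG_eq_of_cqfSymmetric h hd σ 0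
  rw [NG_pathGraph, NG_pathGraph] at key
  have hstrict : ∀ f : Fin (N + 1) → Fin ℓ, ((∀ i : Fin N, f i.castSucc ≠ f i.succ) ∧
      #{i : Fin N | w i.castSucc < w i.succ ↔ f i.castSucc < f i.succ} = 0) ↔ IsStrict S f := by
    intro f
    have hN : #{i : Fin N | w i.castSucc < w i.succ ↔ f i.castSucc < f i.succ} = 0 ↔
        ∀ i : Fin N, ¬ (w i.castSucc < w i.succ ↔ f i.castSucc < f i.succ) := by
      simp [Finset.card_eq_zero, Finset.filter_eq_empty_iff]
    rw [hN, ← forall_and]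
    refine forall_congr' fun i => ?_
    rw [hS]
    rcases lt_trichotomy (f i.castSucc) (f i.succ) with h | h | h
    · simp [h, h.ne, h.not_gt]
    · simp [h]
    · simp [h, h.ne', h.not_gt]
  exact (congrArg card (filter_congr fun f _ => and_congr_right fun _ => (hstrict f).symm)).trans
    (key.trans (congrArg card (filter_congr fun f _ => and_congr_right fun _ => hstrict f)))

theorem exists_surjective_lt_iff {N : ℕ} (e : Fin (N + 1) → ℕ) :
    ∃ (ℓ : ℕ) (d : Fin (N + 1) → Fin (ℓ + 1)), Function.Surjective d ∧
      ∀ u v, d u < d v ↔ e u < e v := by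
  obtain ⟨ℓ, hℓ⟩ : ∃ ℓ, #(univ.image e) = ℓ + 1 :=
    Nat.exists_eq_succ_of_ne_zero (Finset.card_pos.2 ⟨e 0, by simp⟩).ne'
  refine ⟨ℓ, fun v => ((univ.image e).orderIsoOfFin hℓ).symm ⟨e v, by simp⟩, fun a => ?_,
    fun u v => by simp⟩
  have ha := ((univ.image e).orderIsoOfFin hℓ a).2
  obtain ⟨v, -, hv⟩ := Finset.mem_image.1 ha
  refine ⟨v, ?_⟩
  rw [OrderIso.symm_apply_eq]
  exact Subtype.ext hv

open Classical in
theorem StrictSymmetric.card_level_le {N : ℕ} {S : ℕ → Prop} (h : StrictSymmetric N S)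
    {e : Fin (N + 1) → ℕ} (he : IsStrict S e) (t : ℕ) :
    #{v | e v = t} ≤ #{v : Fin (N + 1) | (∀ i : Fin N, i.succ = v → ¬ S i) ∧
      ∀ i : Fin N, i.castSucc = v → S i} := by
  by_cases ht : ∃ x, e x = t
  · obtain ⟨x, rfl⟩ := ht
    obtain ⟨ℓ, d, hd, hde⟩ := exists_surjective_lt_iff e
    have hds : IsStrict S d := by simpa only [IsStrict, hde] using he
    have hcard := h (ℓ + 1) d hd (Equiv.swap 0 (d x))
    have hpos : 0 < #{f : Fin (N + 1) → Fin (ℓ + 1) |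
        content f = content d ∘ Equiv.swap 0 (d x) ∧ IsStrict S f} := by
      rw [← hcard]
      exact Finset.card_pos.2 ⟨d, by simp [hds]⟩
    obtain ⟨f, hf⟩ := Finset.card_pos.1 hpos
    simp only [mem_filter, mem_univ, true_and] at hf
    have h0 := congrFun hf.1 0
    simp only [Function.comp_apply, Equiv.swap_apply_left] at h0
    calc #{v | e v = e x} = content d (d x) := by
          congr 1
          ext v
          simp only [mem_filter, mem_univ, true_and, le_antisymm_iff, ← not_lt, hde]
      _ = content f 0 := h0.symm
      _ ≤ _ := by
        refine Finset.card_le_card fun v hv => ?_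
        simp only [mem_filter, mem_univ, true_and] at hv ⊢
        constructor
        · rintro i rfl hi
          exact absurd ((hf.2 i).1 hi) (by simp [hv])
        · rintro i rfl
          by_contra hi
          exact absurd ((hf.2 i).2 hi) (by simp [hv])
  · rw [Finset.filter_eq_empty_iff.2 fun v _ hv => ht ⟨v, hv⟩]
    simp

open Classical in
theorem card_isWeak_comp_perm {N ℓ : ℕ} (S : ℕ → Prop) (σ : Equiv.Perm (Fin ℓ))
    (m : Fin ℓ → ℕ) :
    #{f : Fin (N + 1) → Fin ℓ | content f = m ∧ IsWeak S f} =
      #{f : Fin (N + 1) → Fin ℓ | content f = m ∘ σ ∧ IsWeak S f} := by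
  have key := sum_wordWeight_comp_perm (N := N)
    (fun i => if S i then ((1 : ℤ), (0 : ℤ), (1 : ℤ)) else (0, 1, 0))
    (fun i j _ => by split_ifs <;> simp) σ m
  have hw : ∀ d : Fin (N + 1) → Fin ℓ, wordWeight
      (fun i : Fin N => if S i then ((1 : ℤ), (0 : ℤ), (1 : ℤ)) else (0, 1, 0)) d =
      if IsWeak S d then 1 else 0 := by
    intro d
    have : ∀ i : Fin N, pairWeight (if S i then ((1 : ℤ), (0 : ℤ), (1 : ℤ)) else (0, 1, 0))
        (d i.castSucc) (d i.succ) = if ((S i → d i.castSucc ≤ d i.succ) ∧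
          (¬ S i → d i.succ < d i.castSucc)) then 1 else 0 := by
      intro i
      rcases lt_trichotomy (d i.castSucc) (d i.succ) with h | h | h <;> by_cases hs : S i <;>
        simp [pairWeight, h, hs, h.le, h.not_gt]
    rw [wordWeight, Finset.prod_congr rfl fun i _ => this i]
    split_ifs with h
    · exact Finset.prod_eq_one fun i _ => if_pos (h i)
    · obtain ⟨i, hi⟩ := not_forall.1 h
      exact Finset.prod_eq_zero (mem_univ i) (if_neg hi)
  simp only [hw, Finset.sum_boole, Finset.filter_filter] at key
  exact_mod_cast key.symm

theorem StrictSymmetric.exists_isWeak_not_isStrict {N ℓ : ℕ} {S : ℕ → Prop}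
    (h : StrictSymmetric N S) {d : Fin (N + 1) → Fin ℓ} (hd : Function.Surjective d)
    (hw : IsWeak S d) (hs : ¬ IsStrict S d) (σ : Equiv.Perm (Fin ℓ)) :
    ∃ f : Fin (N + 1) → Fin ℓ, content f = content d ∘ σ ∧ IsWeak S f ∧ ¬ IsStrict S f := by
  classical
  have hsplit : ∀ m : Fin ℓ → ℕ, #{f : Fin (N + 1) → Fin ℓ | content f = m ∧ IsWeak S f} =
      #{f : Fin (N + 1) → Fin ℓ | content f = m ∧ IsStrict S f} +
      #{f : Fin (N + 1) → Fin ℓ | content f = m ∧ IsWeak S f ∧ ¬ IsStrict S f} := by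
    intro m
    rw [← Finset.card_filter_add_card_filter_not (IsStrict S), Finset.filter_filter,
      Finset.filter_filter]
    congr 2
    · ext f
      simp only [mem_filter, mem_univ, true_and]
      exact ⟨fun hf => ⟨hf.1.1, hf.2⟩, fun hf => ⟨⟨hf.1, fun i =>
        ⟨fun hi => ((hf.2 i).1 hi).le, (hf.2 i).2⟩⟩, hf.2⟩⟩
    · ext f
      simp only [mem_filter, mem_univ, true_and]
      tauto
  have h1 := card_isWeak_comp_perm (N := N) S σ (content d)
  rw [hsplit, hsplit, h ℓ d hd σ, Nat.add_left_cancel_iff] at h1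
  obtain ⟨f, hf⟩ := Finset.card_pos.1 (h1 ▸ Finset.card_pos.2 ⟨d, by simp [hw, hs]⟩)
  exact ⟨f, by simpa using hf⟩

theorem exists_alternating_segment {N : ℕ} {S : ℕ → Prop} (h0 : ¬ S 0)
    (hS : ∃ y, y < N ∧ S y ∧ (y + 1 = N ∨ S (y + 1))) :
    ∃ x y, x < y ∧ y ≤ N ∧ (∀ v, x ≤ v → v < y → (S v ↔ (v - x) % 2 = 1)) ∧
      (x = 0 ∨ ¬ S (x - 1)) ∧ (y < N → S y) ∧ (y - x) % 2 = 0 := by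
  classical
  obtain ⟨hyN, hSy, hy⟩ := Nat.find_spec hS
  have hmin : ∀ v < Nat.find hS, S v → ¬ S (v + 1) := fun v hv hSv h =>
    Nat.find_min hS hv ⟨by omega, hSv, Or.inr h⟩
  set y := Nat.find hS
  set P : ℕ → Prop := fun x => ¬ S x ∧ (x = 0 ∨ ¬ S (x - 1)) with hP
  obtain ⟨x, hx⟩ : ∃ x, x = Nat.findGreatest P y := ⟨_, rfl⟩
  have hxy : x ≤ y := hx ▸ Nat.findGreatest_le y
  have hPx : P x := hx ▸ Nat.findGreatest_spec (Nat.zero_le y) ⟨h0, Or.inl rfl⟩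
  have hmax : ∀ v, x < v → v ≤ y → ¬ P v := fun v h1 h2 =>
    Nat.findGreatest_is_greatest (hx ▸ h1) h2
  have halt : ∀ j, x + j ≤ y → (S (x + j) ↔ j % 2 = 1) := by
    intro j
    induction j with
    | zero => exact fun _ => iff_of_false hPx.1 (by simp)
    | succ j ih =>
      intro hj
      have h1 := ih (by omega)
      have h2 := hmin (x + j) (by omega)
      have h3 := hmax (x + (j + 1)) (by omega) hj
      simp only [hP, not_and_or, not_or, not_not] at h3
      rw [show x + (j + 1) - 1 = x + j by omega] at h3
      rw [show x + j + 1 = x + (j + 1) by omega] at h2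
      by_cases h : S (x + j)
      · have := h1.1 h
        exact iff_of_false (h2 h) (by omega)
      · have : ¬ j % 2 = 1 := fun h' => h (h1.2 h')
        exact iff_of_true (by tauto) (by omega)
  refine ⟨x, y + 1, by omega, by omega, fun v h1 h2 => ?_, hPx.2, fun h => hy.resolve_left h.ne, ?_⟩
  · have := halt (v - x) (by omega)
    rwa [show x + (v - x) = v by omega] at this
  · have := (halt (y - x) (by omega)).1 (by rwa [show x + (y - x) = y by omega])
    omega

theorem StrictSymmetric.not_succ {N : ℕ} {S : ℕ → Prop} (h : StrictSymmetric N S)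
    (h0 : ¬ S 0) {i : ℕ} (hi : i < N) (hSi : S i) : i + 1 < N ∧ ¬ S (i + 1) := by
  classical
  by_contra hcon
  obtain ⟨x, y, hxy, hyN, halt, hx, hy, hpar⟩ := exists_alternating_segment (N := N) h0
    ⟨i, hi, hSi, by
      by_cases h1 : S (i + 1)
      · exact Or.inr h1
      · exact Or.inl (by by_contra h2; exact hcon ⟨by omega, h1⟩)⟩
  obtain ⟨L, hL⟩ : ∃ L : ℕ → Prop, ∀ v, L v ↔ (v = 0 ∨ ¬ S (v - 1)) ∧ (v = N ∨ S v) :=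
    ⟨_, fun _ => Iff.rfl⟩
  obtain ⟨e, he⟩ : ∃ e : ℕ → ℕ, ∀ v, e v = if x ≤ v ∧ v ≤ y then
      (if (v - x) % 2 = 0 then 1 else 0) else if L v then 1
      else if v < N ∧ ¬ S v then 2 * N + 2 - v else v + 2 := ⟨_, fun _ => rfl⟩
  have hstrict : IsStrict S (fun v : Fin (N + 1) => e v) := by
    intro j
    have hj := j.isLt
    simp only [Fin.val_castSucc, Fin.val_succ, he]
    have hL0 := hL j
    have hL1 := hL (j + 1)
    simp only [Nat.add_sub_cancel] at hL1
    generalize (j : ℕ) = v at *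
    have ha := halt v
    by_cases h1 : x ≤ v ∧ v < y
    · have ha := halt v h1.1 h1.2
      constructor <;> intro hs <;> simp only [hs, true_iff, false_iff] at ha <;>
        split_ifs <;> omega
    · have hx' : v + 1 = x → ¬ S v := by
        rintro rfl
        simpa using hx
      have hy' : v = y → S v := fun hvy => hvy ▸ hy (by omega)
      refine ⟨fun hs => ?_, fun hs => ?_⟩
      · have hseg : ¬ (x ≤ v + 1 ∧ v + 1 ≤ y) := fun hseg =>
          hx' (by omega) hs
        have hnL : ¬ L (v + 1) := fun hLv => (hL1.1 hLv).1.elim (by omega) (fun h => h hs)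
        rw [if_neg hseg, if_neg hnL, if_neg (show ¬ (v < N ∧ ¬ S v) from fun h => h.2 hs)]
        split_ifs <;> omega
      · have hseg : ¬ (x ≤ v ∧ v ≤ y) := fun hseg => hs (hy' (by omega))
        have hnL : ¬ L v := fun hLv => (hL0.1 hLv).2.elim (by omega) hs
        rw [if_neg hseg, if_neg hnL, if_pos (show v < N ∧ ¬ S v from ⟨hj, hs⟩)]
        split_ifs <;> omega
  have hle := h.card_level_le hstrict 1
  have hmem : ∀ v : Fin (N + 1), ((∀ i : Fin N, i.succ = v → ¬ S i) ∧
      ∀ i : Fin N, i.castSucc = v → S i) ↔ L v := by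
    intro v
    rw [hL]
    refine and_congr ?_ ?_
    · refine Fin.cases (by simp) (fun j => ?_) v
      simp only [Fin.succ_inj, forall_eq]
      simp
    · refine Fin.lastCases (by simp) (fun j => ?_) v
      simp only [Fin.castSucc_inj, forall_eq]
      simp [j.isLt.ne]
  simp only [hmem] at hle
  have hlt : #{v : Fin (N + 1) | L v} < #{v : Fin (N + 1) | e v = 1} := by
    have hodd : ∀ v, x ≤ v → v ≤ y → L v → (v - x) % 2 = 1 ∧ v < y := by
      intro v h1 h2 hLv
      rw [hL] at hLv
      rcases h2.lt_or_eq with h2 | rfl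
      · have := halt v h1 h2
        have : S v := hLv.2.resolve_left (by omega)
        tauto
      · exfalso
        have := (halt (v - 1) (by omega) (by omega)).2 (by omega)
        exact hLv.1.elim (by omega) (fun h => h this)
    have hxmem : (⟨x, by omega⟩ : Fin (N + 1)) ∈ ({v | e v = 1} : Finset (Fin (N + 1))) := by
      simp [he, hxy.le]
    rw [← Finset.card_erase_add_one hxmem, Nat.lt_succ_iff]
    refine Finset.card_le_card_of_injOn
      (fun v => if hv : x ≤ v ∧ v < y then ⟨v + 1, by omega⟩ else v) (fun v hv => ?_)
      (fun u hu v hv huv => ?_)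
    · simp only [coe_filter, mem_univ, true_and, Set.mem_ofPred_eq] at hv
      have := hodd v
      simp only [coe_erase, coe_filter, mem_univ, true_and, Set.mem_sdiff, Set.mem_ofPred_eq,
        Set.mem_singleton_iff]
      split_ifs with hxv
      · have := this hxv.1 hxv.2.le hv
        simp only [he, Fin.ext_iff]
        rw [if_pos (by omega), if_pos (by omega)]
        simp; omega
      · have hvxy : ¬ (x ≤ v ∧ v ≤ y) := by
          rintro ⟨h1, h2⟩
          exact hxv ⟨h1, (this h1 h2 hv).2⟩
        rw [he, if_neg hvxy, if_pos hv, Fin.ext_iff]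
        simp; omega
    · simp only [coe_filter, mem_univ, true_and, Set.mem_ofPred_eq] at hu hv
      have hu' := hodd u
      have hv' := hodd v
      simp only [hu, hv, forall_const] at hu' hv'
      rw [Fin.ext_iff]
      dsimp only at huv
      split_ifs at huv <;> simp only [Fin.ext_iff] at huv <;> omega
  omega

theorem StrictSymmetric.forall_not {N : ℕ} {S : ℕ → Prop} (h : StrictSymmetric N S)
    (h0 : ¬ S 0) {i : ℕ} (hi : i < N) : ¬ S i := by
  classical
  intro hSi
  have hns : ∀ j < N, S j → j + 1 < N ∧ ¬ S (j + 1) := fun j hj => h.not_succ h0 hj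
  have hpos : ∀ j, S j → j ≠ 0 := by
    rintro j hj rfl
    exact h0 hj
  have hpred : ∀ j < N, S j → ¬ S (j - 1) := by
    intro j hj hSj hSj'
    have := (hns (j - 1) (by omega) hSj').2
    rw [Nat.sub_add_cancel (Nat.one_le_iff_ne_zero.2 (hpos j hSj))] at this
    exact this hSj
  obtain ⟨g, hg⟩ : ∃ g : ℕ → ℕ, ∀ v, g v = if v = 0 then N + 1 else
      if S (v - 1) then N + 1 + v else N + 1 - v := ⟨_, fun _ => rfl⟩
  have hgle : ∀ v, N + 1 - v ≤ g v := by
    intro v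
    rw [hg]
    split_ifs <;> omega
  have hgS : ∀ j < N, S j → g j = N + 1 - j := by
    intro j hj hSj
    rw [hg, if_neg (hpos j hSj), if_neg (hpred j hj hSj)]
  have hgsucc : ∀ j, (S j → g (j + 1) = N + 1 + (j + 1)) ∧ (¬ S j → g (j + 1) = N + 1 - (j + 1)) := by
    intro j
    rw [hg, if_neg (Nat.succ_ne_zero j), Nat.add_sub_cancel]
    exact ⟨fun hj => if_pos hj, fun hj => if_neg hj⟩
  have hginj : ∀ u ≤ N, ∀ v ≤ N, g u = g v → u = v := by
    intro u hu v hv huv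
    rw [hg, hg] at huv
    split_ifs at huv <;> omega
  obtain ⟨e, he⟩ : ∃ e : ℕ → ℕ, ∀ v, e v = if v = i + 1 then g i else g v := ⟨_, fun _ => rfl⟩
  have heinj : ∀ u ≤ N, ∀ v ≤ N, u ≠ v → e u = e v → e u = e i := by
    intro u hu v hv hne huv
    have h1 := hginj u hu v hv
    have h2 := hginj u hu i hi.le
    have h3 := hginj i hi.le v hv
    simp only [he] at huv ⊢
    rw [if_neg (show i ≠ i + 1 by omega)]
    split_ifs at huv ⊢ with h4 h5
    · rfl
    · rfl
    · exact huv
    · exact absurd (h1 huv) hne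
  have hweak : IsWeak S (fun v : Fin (N + 1) => e v) := by
    intro j
    have hj := j.isLt
    simp only [Fin.val_castSucc, Fin.val_succ, he]
    generalize (j : ℕ) = v at *
    refine ⟨fun hs => ?_, fun hs => ?_⟩
    · have hvi : v ≠ i + 1 := fun hvi => (hns i hi hSi).2 (hvi ▸ hs)
      have h1 := hgS v hj hs
      have h2 := (hgsucc v).1 hs
      rw [if_neg hvi]
      split_ifs with h3
      · rw [show v = i by omega]
      · omega
    · have hvi : v + 1 ≠ i + 1 := fun hvi => hs (by rwa [show v = i by omega])
      have h1 := hgS i hi hSi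
      have h2 := (hgsucc v).2 hs
      have h3 := hgle v
      rw [if_neg hvi]
      split_ifs with h3 <;> omega
  obtain ⟨ℓ, d, hd, hde⟩ := exists_surjective_lt_iff (fun v : Fin (N + 1) => e v)
  have hdw : IsWeak S d := by simpa only [IsWeak, ← not_lt, hde] using hweak
  have hds : ¬ IsStrict S d := by
    intro hds
    have := (hds ⟨i, hi⟩).1 hSi
    rw [hde] at this
    simp [he] at this
  have hdeq : ∀ u v, d u = d v ↔ e u = e v := by
    intro u v
    simp only [le_antisymm_iff, ← not_lt, hde]
  have hiN : i < N + 1 := by omega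
  obtain ⟨f, hfc, hfw, hfs⟩ := h.exists_isWeak_not_isStrict hd hdw hds
    (Equiv.swap 0 (d ⟨i, hiN⟩))
  obtain ⟨j, hj, hfj⟩ : ∃ j : Fin N, S j ∧ f j.castSucc = f j.succ := by
    by_contra hcon
    push Not at hcon
    exact hfs fun j => ⟨fun hj => lt_of_le_of_ne ((hfw j).1 hj) (hcon j hj), (hfw j).2⟩
  have htwo : 1 < content f (f j.castSucc) :=
    Finset.one_lt_card.2 ⟨j.castSucc, by simp, j.succ, by simp [hfj], Fin.castSucc_lt_succ.ne⟩
  rw [hfc, Function.comp_apply] at htwo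
  obtain ⟨u, hu, v, hv, huv⟩ := Finset.one_lt_card.1 htwo
  simp only [mem_filter, mem_univ, true_and] at hu hv
  have hui : d u = d ⟨i, hiN⟩ := (hdeq _ _).2 (heinj u (by omega) v (by omega)
    (fun h => huv (Fin.ext h)) ((hdeq u v).1 (hu.trans hv.symm)))
  have hzero : f j.castSucc = 0 := by
    rw [← Equiv.apply_eq_iff_eq (Equiv.swap 0 (d ⟨i, hiN⟩)), ← hu, hui, Equiv.swap_apply_left]
  obtain ⟨h1, h2⟩ := hns j j.isLt hj
  have h3 := (hfw ⟨j + 1, h1⟩).2 h2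
  rw [show (⟨j + 1, h1⟩ : Fin N).castSucc = j.succ from rfl, ← hfj, hzero] at h3
  exact Fin.not_lt_zero _ h3

theorem eq_of_forall_castSucc_lt_succ {N : ℕ} {w : Equiv.Perm (Fin (N + 1))}
    (h : ∀ i : Fin N, w i.castSucc < w i.succ) (i : Fin (N + 1)) : w i = i :=
  congrFun ((StrictMono.range_inj (Fin.strictMono_iff_lt_succ.2 h) strictMono_id).1 (by simp)) i

theorem eq_rev_of_forall_succ_lt_castSucc {N : ℕ} {w : Equiv.Perm (Fin (N + 1))}
    (h : ∀ i : Fin N, w i.succ < w i.castSucc) (i : Fin (N + 1)) : w i = i.rev := by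
  have := eq_of_forall_castSucc_lt_succ (w := w.trans Fin.revPerm)
    (fun i => by simpa using h i) i
  rw [← Fin.rev_inj, Fin.rev_rev]
  exact this

end

/-- The chromatic quasisymmetric function of the labeled path `P_w`
is symmetric if and only if `w` is the identity labeling `1,2,…,n` or its
reversal `n,…,2,1`. -/
theorem stmt0 (n : ℕ) (hn : 1 ≤ n) (w : Equiv.Perm (Fin n)) :
    cqfSymmetric (pathGraph w) ↔
      ((∀ i : Fin n, w i = i) ∨ (∀ i : Fin n, ((w i : ℕ) = n - 1 - (i : ℕ)))) := by
  obtain ⟨N, rfl⟩ := Nat.exists_eq_add_of_le' hn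
  constructor
  · intro h
    obtain ⟨S, hS⟩ : ∃ S : ℕ → Prop, ∀ i : Fin N, S i ↔ w i.castSucc < w i.succ :=
      ⟨fun i => ∃ hi : i < N, w (Fin.castSucc ⟨i, hi⟩) < w (Fin.succ ⟨i, hi⟩),
        fun i => ⟨fun ⟨_, hi⟩ => hi, fun hi => ⟨i.isLt, hi⟩⟩⟩
    by_cases h0 : S 0
    · refine Or.inl (eq_of_forall_castSucc_lt_succ fun i => ?_)
      rw [← hS]
      exact not_not.1 ((strictSymmetric_not_of_cqfSymmetric h (S := fun i => ¬ S i)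
        fun i => not_congr (hS i)).forall_not (not_not.2 h0) i.isLt)
    · refine Or.inr fun i => ?_
      rw [eq_rev_of_forall_succ_lt_castSucc (w := w) (fun i => ?_) i, Fin.val_rev]
      · omega
      · have hi := (strictSymmetric_of_cqfSymmetric h hS).forall_not h0 i.isLt
        rw [hS, not_lt] at hi
        exact lt_of_le_of_ne hi fun heq => Fin.castSucc_lt_succ.ne' (w.injective heq)
  · rintro (h | h)
    · exact cqfSymmetric_pathGraph_of_lt_iff w True fun i => by simp [h]
    · refine cqfSymmetric_pathGraph_of_lt_iff w False fun i => ?_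
      have h1 := h i.castSucc
      have h2 := h i.succ
      rw [Fin.val_castSucc] at h1
      rw [Fin.val_succ] at h2
      rw [Fin.lt_def, iff_false]
      omega
end

section
/- Let G be a labeled graph on n vertices with m edges and let G' be the flipped labeled graph of G. Then for every composition α of n and every 0 ≤ k ≤ m, N_G(α,k) + N_{G'}(α,k) = N_G(α,m−k) + N_{G'}(α,m−k); that is, the sum of the chromatic quasisymmetric functions of G and G' is palindromic. -/
/-- Reversing the labels turns descents into ascents. -/
theorem ascNum_flipGraph {n : ℕ} (G : SimpleGraph (Fin n)) (c : Fin n → ℕ) :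
    ascNum (flipGraph G) (c ∘ Fin.rev) = desNum G c := by
  refine Nat.card_congr (Equiv.subtypeEquiv
    ((Equiv.prodComm _ _).trans (Fin.revPerm.prodCongr Fin.revPerm)) fun p => ?_)
  simp [flipGraph, G.adj_comm]

/-- Ordered pairs of adjacent labels correspond to edges. -/
theorem card_lt_adj_eq_edgeCount {n : ℕ} (G : SimpleGraph (Fin n)) :
    Nat.card {p : Fin n × Fin n // p.1 < p.2 ∧ G.Adj p.1 p.2} = edgeCount G := by
  refine Nat.card_congr (Equiv.ofBijective
    (fun p => (⟨s(p.1.1, p.1.2), p.2.2⟩ : G.edgeSet)) ⟨?_, ?_⟩)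
  · rintro ⟨⟨a, b⟩, hab, _⟩ ⟨⟨x, y⟩, hxy, _⟩ h
    have h' : s(a, b) = s(x, y) := congrArg Subtype.val h
    rcases Sym2.eq_iff.1 h' with ⟨rfl, rfl⟩ | ⟨rfl, rfl⟩
    · rfl
    · exact absurd hab hxy.asymm
  · rintro ⟨e, he⟩
    induction e using Sym2.ind with
    | _ a b =>
      have hadj : G.Adj a b := he
      rcases lt_or_gt_of_ne hadj.ne with h | h
      · exact ⟨⟨(a, b), h, hadj⟩, rfl⟩
      · exact ⟨⟨(b, a), h, hadj.symm⟩, Subtype.ext Sym2.eq_swap⟩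

/-- Every edge of a properly colored graph is either an ascent or a descent. -/
theorem ascNum_add_desNum {n : ℕ} {G : SimpleGraph (Fin n)} {c : Fin n → ℕ}
    (hc : properColoring G c) : ascNum G c + desNum G c = edgeCount G := by
  classical
  rw [← card_lt_adj_eq_edgeCount, ascNum, desNum]
  simp only [Nat.card_eq_fintype_card, Fintype.card_subtype]
  rw [← Finset.card_union_of_disjoint]
  · congr 1
    ext p
    have := hc p.1 p.2
    simp only [Finset.mem_union, Finset.mem_filter, Finset.mem_univ, true_and]
    grind
  · rw [Finset.disjoint_filter]
    rintro p - ⟨_, _, h⟩ ⟨_, _, h'⟩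
    exact h.asymm h'

theorem properColoring_flipGraph {n : ℕ} (G : SimpleGraph (Fin n)) (c : Fin n → ℕ) :
    properColoring (flipGraph G) (c ∘ Fin.rev) ↔ properColoring G c := by
  refine ⟨fun h u v huv => ?_, fun h u v huv => h _ _ huv⟩
  simpa using h u.rev v.rev (by simpa [flipGraph] using huv)

theorem usesPalette_comp_rev {n : ℕ} (L : List ℕ) (c : Fin n → ℕ) :
    usesPalette L (c ∘ Fin.rev) ↔ usesPalette L c := by
  refine and_congr ?_ (forall_congr' fun i => ?_)
  · exact Fin.revPerm.forall_congr fun v => by simp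
  · rw [Nat.card_congr (Equiv.subtypeEquiv Fin.revPerm fun v => by simp :
      {v : Fin n // (c ∘ Fin.rev) v = (i : ℕ) + 1} ≃ {v : Fin n // c v = (i : ℕ) + 1})]

/-- Flipping a graph exchanges the ascent number `k` with its complement. -/
theorem NG_eq_NG_flipGraph {n : ℕ} (G : SimpleGraph (Fin n)) (L : List ℕ) {k : ℕ}
    (hk : k ≤ edgeCount G) : NG G L k = NG (flipGraph G) L (edgeCount G - k) := by
  refine Nat.card_congr (Equiv.subtypeEquiv
    (Fin.revPerm.arrowCongr (Equiv.refl ℕ)) fun c => ?_)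
  have hrev : Fin.revPerm.arrowCongr (Equiv.refl ℕ) c = c ∘ Fin.rev := rfl
  rw [hrev, properColoring_flipGraph, usesPalette_comp_rev, ascNum_flipGraph]
  refine and_congr_right fun hc => and_congr_right fun _ => ?_
  have := ascNum_add_desNum hc
  omega

/-- The sum of the CQFs of a labeled graph and its flip is palindromic. -/
theorem stmt1 (n : ℕ) (G : SimpleGraph (Fin n)) (L : List ℕ)
    (hL : IsComposition n L) (k : ℕ) (hk : k ≤ edgeCount G) :
    NG G L k + NG (flipGraph G) L k =
      NG G L (edgeCount G - k) + NG (flipGraph G) L (edgeCount G - k) := by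
  have h := NG_eq_NG_flipGraph G L (Nat.sub_le (edgeCount G) k)
  rw [Nat.sub_sub_self hk] at h
  rw [NG_eq_NG_flipGraph G L hk, h, add_comm]
end

section
/- Let w = (w_1,…,w_n) be a permutation of {1,…,n} such that the chromatic quasisymmetric function of the labeled path P_w is symmetric, and let w' be the permutation defined by w'_i = n+1−w_i. Then N_{P_{w'}}(α,k) = N_{P_w}(α,k) for every composition α of n and every k; in particular, the chromatic quasisymmetric function of P_{w'} is symmetric. -/
/-- Reverse both the vertex labels and the colors `1,…,ℓ` of a coloring. -/
def flipColoring {n : ℕ} (ℓ : ℕ) (c : Fin n → ℕ) : Fin n → ℕ :=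
  fun v => ℓ + 1 - c v.rev

theorem flipColoring_flipColoring {n ℓ : ℕ} {c : Fin n → ℕ} (hc : ∀ v, c v ≤ ℓ) :
    flipColoring ℓ (flipColoring ℓ c) = c := by
  funext v
  have := hc v
  simp only [flipColoring, Fin.rev_rev]
  omega

theorem properColoring_flipColoring {n ℓ : ℕ} {G G' : SimpleGraph (Fin n)}
    (hG : ∀ u v, G'.Adj u v ↔ G.Adj u.rev v.rev) {c : Fin n → ℕ} (hc : ∀ v, c v ≤ ℓ)
    (h : properColoring G c) : properColoring G' (flipColoring ℓ c) := by
  intro u v huv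
  have hne := h _ _ ((hG u v).1 huv)
  have hu := hc u.rev
  have hv := hc v.rev
  simp only [flipColoring]
  omega

theorem usesPalette_flipColoring {n : ℕ} {L : List ℕ} {c : Fin n → ℕ}
    (h : usesPalette L c) : usesPalette L.reverse (flipColoring L.length c) := by
  refine ⟨fun v => ?_, fun i => ?_⟩
  · have := h.1 v.rev
    simp only [flipColoring, List.length_reverse]
    omega
  · have hi : (i : ℕ) < L.length := by simpa using i.isLt
    have hcount := h.2 ⟨L.length - 1 - i, by omega⟩
    simp only [List.get_eq_getElem, List.getElem_reverse] at hcount ⊢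
    rw [← hcount]
    refine Nat.card_congr (Fin.revPerm.subtypeEquiv fun v => ?_)
    have := h.1 v.rev
    simp only [flipColoring, Fin.revPerm_apply]
    omega

theorem ascNum_flipColoring {n ℓ : ℕ} {G G' : SimpleGraph (Fin n)}
    (hG : ∀ u v, G'.Adj u v ↔ G.Adj u.rev v.rev) {c : Fin n → ℕ} (hc : ∀ v, c v ≤ ℓ) :
    ascNum G' (flipColoring ℓ c) = ascNum G c := by
  refine Nat.card_congr
    (((Equiv.prodComm _ _).trans (Fin.revPerm.prodCongr Fin.revPerm)).subtypeEquiv fun p => ?_)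
  have h₁ := hc p.1.rev
  have h₂ := hc p.2.rev
  have hlt : ℓ + 1 - c p.1.rev < ℓ + 1 - c p.2.rev ↔ c p.2.rev < c p.1.rev := by omega
  simp [flipColoring, hlt, hG, G.adj_comm]

theorem NG_eq_NG_reverse {n : ℕ} {G G' : SimpleGraph (Fin n)}
    (hG : ∀ u v, G'.Adj u v ↔ G.Adj u.rev v.rev) (L : List ℕ) (k : ℕ) :
    NG G' L k = NG G L.reverse k := by
  have hG' : ∀ u v, G.Adj u v ↔ G'.Adj u.rev v.rev := fun u v => by simp [hG]
  refine Nat.card_congr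
    { toFun := fun c => ⟨flipColoring L.length c.1, ?_⟩
      invFun := fun c => ⟨flipColoring L.length c.1, ?_⟩
      left_inv := fun c => Subtype.ext
        (flipColoring_flipColoring fun v => (c.2.2.1.1 v).2)
      right_inv := fun c => Subtype.ext
        (flipColoring_flipColoring fun v => by simpa using (c.2.2.1.1 v).2) }
  · obtain ⟨c, hp, hu, ha⟩ := c
    have hc : ∀ v, c v ≤ L.length := fun v => (hu.1 v).2
    exact ⟨properColoring_flipColoring hG' hc hp, usesPalette_flipColoring hu,
      (ascNum_flipColoring hG' hc).trans ha⟩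
  · obtain ⟨c, hp, hu, ha⟩ := c
    have hc : ∀ v, c v ≤ L.length := fun v => by simpa using (hu.1 v).2
    exact ⟨properColoring_flipColoring hG hc hp, by simpa using usesPalette_flipColoring hu,
      (ascNum_flipColoring hG hc).trans ha⟩

theorem pathGraph_adj_rev {n : ℕ} {w w' : Equiv.Perm (Fin n)} (hw' : ∀ i, w' i = (w i).rev)
    (u v : Fin n) : (pathGraph w').Adj u v ↔ (pathGraph w).Adj u.rev v.rev := by
  simp [pathGraph, SimpleGraph.fromRel_adj, hw', Fin.rev_eq_iff]


/-- If the CQF of `P_w` is symmetric and `w'_i = n+1-w_i`, then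
`N_{P_{w'}}(α,k) = N_{P_w}(α,k)` for all compositions `α` of `n` and all `k`;
in particular the CQF of `P_{w'}` is symmetric. -/
theorem stmt4 (n : ℕ) (w w' : Equiv.Perm (Fin n)) (hw' : ∀ i, w' i = (w i).rev)
    (hsym : cqfSymmetric (pathGraph w)) :
    (∀ L : List ℕ, IsComposition n L →
      ∀ k : ℕ, NG (pathGraph w') L k = NG (pathGraph w) L k) ∧
    cqfSymmetric (pathGraph w') := by
  have key : ∀ L : List ℕ, IsComposition n L →
      ∀ k : ℕ, NG (pathGraph w') L k = NG (pathGraph w) L k := by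
    intro L hL k
    rw [NG_eq_NG_reverse (pathGraph_adj_rev hw')]
    exact hsym _ _ ⟨by simpa using hL.1, by simpa using hL.2⟩ hL L.reverse_perm k
  refine ⟨key, fun L M hL hM hLM k => ?_⟩
  rw [key L hL, key M hM]
  exact hsym L M hL hM hLM k
end

section
/- Let w = (w_1,…,w_n) be a permutation of {1,…,n} such that the number of local minima of w differs from the number of local maxima of w. Then the chromatic quasisymmetric function of the labeled path P_w is not palindromic, and hence not symmetric. -/
theorem finite_colorings_usesPalette {n : ℕ} (L : List ℕ) (P : (Fin n → ℕ) → Prop)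
    (hP : ∀ c, P c → usesPalette L c) : Finite {c : Fin n → ℕ // P c} :=
  Set.Finite.subset (Set.Finite.pi fun _ : Fin n => Set.finite_Iic L.length)
    fun c hc v _ => ((hP c hc).1 v).2

theorem NG_ne_zero_iff {n : ℕ} (G : SimpleGraph (Fin n)) (L : List ℕ) (k : ℕ) :
    NG G L k ≠ 0 ↔ ∃ c, properColoring G c ∧ usesPalette L c ∧ ascNum G c = k := by
  have := finite_colorings_usesPalette L
    (fun c : Fin n → ℕ => properColoring G c ∧ usesPalette L c ∧ ascNum G c = k)
    fun c hc => hc.2.1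
  unfold NG
  rw [← Nat.pos_iff_ne_zero, Nat.card_pos_iff]
  simp [this, nonempty_subtype]

theorem edgeCount_eq_card_lt {n : ℕ} (G : SimpleGraph (Fin n)) :
    edgeCount G = Nat.card {p : Fin n × Fin n // p.1 < p.2 ∧ G.Adj p.1 p.2} := by
  symm
  refine Nat.card_eq_of_bijective
    (fun p => (⟨s(p.1.1, p.1.2), p.2.2⟩ : G.edgeSet)) ⟨?_, ?_⟩
  · rintro ⟨⟨a, b⟩, hab, _⟩ ⟨⟨c, d⟩, hcd, _⟩ h
    replace h := Sym2.eq_iff.1 (congrArg Subtype.val h)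
    simp only [Subtype.mk.injEq, Prod.mk.injEq]
    dsimp at hab hcd
    rcases h with h | ⟨rfl, rfl⟩
    · exact h
    · exact absurd hab hcd.asymm
  · rintro ⟨e, he⟩
    induction e using Sym2.ind with
    | _ a b =>
      have hab : G.Adj a b := he
      rcases lt_or_gt_of_ne hab.ne with h | h
      · exact ⟨⟨(a, b), h, hab⟩, rfl⟩
      · exact ⟨⟨(b, a), h, hab.symm⟩, Subtype.ext Sym2.eq_swap⟩

theorem ascNum_eq_zero_iff {n : ℕ} (G : SimpleGraph (Fin n)) (c : Fin n → ℕ) :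
    ascNum G c = 0 ↔ ∀ u v, u < v → G.Adj u v → ¬ c u < c v := by
  simp [ascNum, Finite.card_eq_zero_iff, isEmpty_subtype]

theorem desNum_eq_zero_iff {n : ℕ} (G : SimpleGraph (Fin n)) (c : Fin n → ℕ) :
    desNum G c = 0 ↔ ∀ u v, u < v → G.Adj u v → ¬ c v < c u := by
  simp [desNum, Finite.card_eq_zero_iff, isEmpty_subtype]

/-- Replacing each color `a` by `L.length + 1 - a` reverses the palette. -/
theorem usesPalette_reverse {n : ℕ} {L : List ℕ} {c : Fin n → ℕ} (hc : usesPalette L c) :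
    usesPalette L.reverse (fun v => L.length + 1 - c v) := by
  refine ⟨fun v => ?_, fun i => ?_⟩
  · have := hc.1 v
    simp only [List.length_reverse]
    omega
  · have hi : (i : ℕ) < L.length := by simpa using i.2
    have h := hc.2 ⟨L.length - 1 - i, by omega⟩
    simp only [List.get_eq_getElem, List.getElem_reverse] at h ⊢
    rw [← h]
    refine Nat.card_congr (Equiv.subtypeEquivRight fun v => ?_)
    have := hc.1 v
    omega

theorem NG_le_NG_reverse {n : ℕ} (G : SimpleGraph (Fin n)) (L : List ℕ) (k : ℕ) :
    NG G L k ≤ NG G L.reverse (edgeCount G - k) := by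
  have := finite_colorings_usesPalette L.reverse
    (fun c : Fin n → ℕ => properColoring G c ∧ usesPalette L.reverse c ∧
      ascNum G c = edgeCount G - k) fun c hc => hc.2.1
  have key : ∀ c : Fin n → ℕ, properColoring G c → usesPalette L c →
      ascNum G (fun v => L.length + 1 - c v) = desNum G c := by
    intro c _ h2
    refine Nat.card_congr (Equiv.subtypeEquivRight fun p => ?_)
    have h3 := h2.1 p.1
    have h4 := h2.1 p.2
    have : L.length + 1 - c p.1 < L.length + 1 - c p.2 ↔ c p.2 < c p.1 := by omega
    simp only [this]
  refine Nat.card_le_card_of_injective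
    (fun c => ⟨fun v => L.length + 1 - c.1 v, ?_, usesPalette_reverse c.2.2.1, ?_⟩) ?_
  · intro u v huv
    have := c.2.1 u v huv
    have := c.2.2.1.1 u
    have := c.2.2.1.1 v
    dsimp only
    omega
  · rw [key c.1 c.2.1 c.2.2.1]
    have := ascNum_add_desNum c.2.1
    have := c.2.2.2
    omega
  · intro c d hcd
    simp only [Subtype.mk.injEq] at hcd
    ext v
    have := congrFun hcd v
    have := c.2.2.1.1 v
    have := d.2.2.1.1 v
    omega

theorem cqfSymmetric.cqfPalindromic {n : ℕ} {G : SimpleGraph (Fin n)} (h : cqfSymmetric G) :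
    cqfPalindromic G := by
  intro L hL k hk
  have hrev : IsComposition n L.reverse := by
    simpa [IsComposition, List.sum_reverse] using hL
  have hle (j : ℕ) : NG G L j ≤ NG G L (edgeCount G - j) :=
    (NG_le_NG_reverse G L j).trans_eq
      (h L L.reverse hL hrev (List.reverse_perm L).symm (edgeCount G - j)).symm
  refine (hle k).antisymm ?_
  simpa [Nat.sub_sub_self hk] using hle (edgeCount G - k)

/-- Color a set `S` with color `1` and all other vertices with distinct colors, in the order
prescribed by `r`. -/
theorem exists_coloring_one_on {n : ℕ} (S : Finset (Fin n)) (r : Fin n → Fin n)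
    (hr : Function.Injective r) :
    ∃ c : Fin n → ℕ, usesPalette (S.card :: List.replicate (n - S.card) 1) c ∧
      (∀ v ∈ S, c v = 1) ∧ (∀ v ∉ S, 1 < c v) ∧
      ∀ u ∉ S, ∀ v ∉ S, r u < r v → c u < c v := by
  classical
  let rank : Fin n → ℕ := fun v => (Sᶜ.filter fun u => r u < r v).card
  have hcard : Sᶜ.card = n - S.card := by simp [Finset.card_compl]
  have hlt : ∀ v ∉ S, rank v < n - S.card := by
    intro v hv
    rw [← hcard]
    refine Finset.card_lt_card ((Finset.filter_ssubset).2 ⟨v, by simpa using hv, lt_irrefl _⟩)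
  have hmono : ∀ u ∉ S, ∀ v, r u < r v → rank u < rank v := by
    intro u hu v huv
    refine Finset.card_lt_card ((Finset.ssubset_iff_of_subset ?_).2 ⟨u, ?_, ?_⟩)
    · intro x hx
      simp only [Finset.mem_filter] at hx ⊢
      exact ⟨hx.1, hx.2.trans huv⟩
    · simpa using ⟨hu, huv⟩
    · simp
  have hbij : Function.Bijective
      (fun v : {v // v ∈ Sᶜ} =>
        (⟨rank v, hlt v (Finset.mem_compl.1 v.2)⟩ : Fin (n - S.card))) := by
    refine (Fintype.bijective_iff_injective_and_card _).2 ⟨?_, by simp⟩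
    intro u v huv
    have huv' : rank u = rank v := congrArg Fin.val huv
    have hu : (u : Fin n) ∉ S := Finset.mem_compl.1 u.2
    have hv : (v : Fin n) ∉ S := Finset.mem_compl.1 v.2
    rcases lt_trichotomy (r u) (r v) with h | h | h
    · exact absurd huv' (hmono u hu v h).ne
    · exact Subtype.ext (hr h)
    · exact absurd huv' (hmono v hv u h).ne'
  refine ⟨fun v => if v ∈ S then 1 else rank v + 2, ⟨fun v => ?_, fun i => ?_⟩, ?_, ?_, ?_⟩
  · by_cases hv : v ∈ S
    · simp [hv]
    · have := hlt v hv
      simp only [hv, if_false, List.length_cons, List.length_replicate]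
      omega
  · obtain ⟨i, hi⟩ := i
    cases i with
    | zero =>
      have : ∀ v, (if v ∈ S then 1 else rank v + 2) = 0 + 1 ↔ v ∈ S := by
        intro v
        split_ifs with hv <;> simp [hv]
      simp [this]
    | succ i =>
      have hi' : i < n - S.card := by simpa using hi
      obtain ⟨⟨x, hx⟩, hxi⟩ := hbij.2 ⟨i, hi'⟩
      have hxS : x ∉ S := by simpa using hx
      have hxi' : rank x = i := congrArg Fin.val hxi
      simp only [List.get_eq_getElem, List.getElem_cons_succ, List.getElem_replicate]
      rw [Nat.card_eq_one_iff_unique]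
      refine ⟨⟨?_⟩, ⟨x, ?_⟩⟩
      · have huniq : ∀ v, (if v ∈ S then 1 else rank v + 2) = i + 1 + 1 → v = x := by
          intro v hv
          split_ifs at hv with hvS
          · omega
          have := @hbij.1 ⟨v, by simpa using hvS⟩ ⟨x, hx⟩ (Fin.ext (by dsimp only; omega))
          exact congrArg Subtype.val this
        rintro ⟨u, hu⟩ ⟨v, hv⟩
        exact Subtype.ext ((huniq u hu).trans (huniq v hv).symm)
      · simp [hxS, hxi']
  · intro v hv
    simp [hv]
  · intro v hv
    simp [hv]
  · intro u hu v hv huv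
    simpa [hu, hv] using hmono u hu v huv

theorem isComposition_card_cons_replicate {n : ℕ} {S : Finset (Fin n)} (hS : 0 < S.card) :
    IsComposition n (S.card :: List.replicate (n - S.card) 1) := by
  have : S.card ≤ n := by simpa using S.card_le_univ
  refine ⟨?_, ?_⟩
  · intro a ha
    rcases List.mem_cons.1 ha with rfl | ha
    · exact hS
    · simp [List.eq_of_mem_replicate ha]
  · simp
    omega

theorem card_le_of_usesPalette_cons {n a : ℕ} {L : List ℕ} {c : Fin n → ℕ}
    (hc : usesPalette (a :: L) c) (T : Finset (Fin n))
    (hT : ∀ v, c v = 1 → v ∈ T) : a ≤ T.card := by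
  have h : Nat.card {v // c v = 1} = a := hc.2 ⟨0, by simp⟩
  rw [← h, Nat.card_eq_fintype_card, Fintype.card_subtype]
  exact Finset.card_le_card fun v hv => hT v (by simpa using hv)

/-- In a graph with palindromic chromatic quasisymmetric function, as many vertices are smaller
than all their neighbors as are larger than all their neighbors. -/
theorem cqfPalindromic.card_min_eq_card_max {n : ℕ} {G : SimpleGraph (Fin n)}
    (hG : cqfPalindromic G) :
    Nat.card {v // ∀ u, G.Adj v u → v < u} = Nat.card {v // ∀ u, G.Adj v u → u < v} := by
  classical
  simp only [Nat.card_eq_fintype_card, Fintype.card_subtype]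
  set S := Finset.univ.filter fun v => ∀ u, G.Adj v u → v < u
  set T := Finset.univ.filter fun v => ∀ u, G.Adj v u → u < v
  apply le_antisymm
  · rcases Nat.eq_zero_or_pos S.card with h0 | h0
    · omega
    obtain ⟨c, hpal, h1, h2, h3⟩ := exists_coloring_one_on S id Function.injective_id
    have hasc : ∀ u v, u < v → G.Adj u v → c u < c v := by
      intro u v huv hadj
      have hv : v ∉ S := fun hv => huv.asymm ((Finset.mem_filter.1 hv).2 u hadj.symm)
      by_cases hu : u ∈ S
      · rw [h1 u hu]
        exact h2 v hv
      · exact h3 u hu v hv huv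
    have hproper : properColoring G c := by
      intro u v hadj
      rcases lt_or_gt_of_ne hadj.ne with h | h
      · exact (hasc u v h hadj).ne
      · exact (hasc v u h hadj.symm).ne'
    have hdes := (desNum_eq_zero_iff G c).2 fun u v h hadj => (hasc u v h hadj).asymm
    have hsum := ascNum_add_desNum hproper
    have hne := (NG_ne_zero_iff G _ (edgeCount G)).2 ⟨c, hproper, hpal, by omega⟩
    rw [hG _ (isComposition_card_cons_replicate h0) _ le_rfl, Nat.sub_self,
      NG_ne_zero_iff] at hne
    obtain ⟨d, hd, hdpal, hd0⟩ := hne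
    rw [ascNum_eq_zero_iff] at hd0
    refine card_le_of_usesPalette_cons hdpal T fun v hv => ?_
    refine Finset.mem_filter.2 ⟨Finset.mem_univ v, fun u hadj => ?_⟩
    by_contra hlt
    have huv : v < u := lt_of_le_of_ne (not_lt.1 hlt) hadj.ne
    have := hd0 v u huv hadj
    have := hd v u hadj
    have := (hdpal.1 u).1
    omega
  · rcases Nat.eq_zero_or_pos T.card with h0 | h0
    · omega
    obtain ⟨c, hpal, h1, h2, h3⟩ := exists_coloring_one_on T Fin.rev Fin.rev_injective
    have hdes : ∀ u v, u < v → G.Adj u v → c v < c u := by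
      intro u v huv hadj
      have hu : u ∉ T := fun hu => huv.asymm ((Finset.mem_filter.1 hu).2 v hadj)
      by_cases hv : v ∈ T
      · rw [h1 v hv]
        exact h2 u hu
      · exact h3 v hv u hu (Fin.rev_lt_rev.2 huv)
    have hproper : properColoring G c := by
      intro u v hadj
      rcases lt_or_gt_of_ne hadj.ne with h | h
      · exact (hdes u v h hadj).ne'
      · exact (hdes v u h hadj.symm).ne
    have hasc := (ascNum_eq_zero_iff G c).2 fun u v h hadj => (hdes u v h hadj).asymm
    have hne := (NG_ne_zero_iff G _ 0).2 ⟨c, hproper, hpal, hasc⟩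
    rw [hG _ (isComposition_card_cons_replicate h0) _ (Nat.zero_le _), Nat.sub_zero,
      NG_ne_zero_iff] at hne
    obtain ⟨d, hd, hdpal, hdm⟩ := hne
    have hsum := ascNum_add_desNum hd
    have hd0 := (desNum_eq_zero_iff G d).1 (by omega)
    refine card_le_of_usesPalette_cons hdpal S fun v hv => ?_
    refine Finset.mem_filter.2 ⟨Finset.mem_univ v, fun u hadj => ?_⟩
    by_contra hlt
    have huv : u < v := lt_of_le_of_ne (not_lt.1 hlt) hadj.ne'
    have := hd0 u v huv hadj.symm
    have := hd v u hadj
    have := (hdpal.1 u).1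
    omega

theorem pathGraph_forall_adj_iff {n : ℕ} (w : Equiv.Perm (Fin n)) (i : Fin n)
    (P : Fin n → Prop) :
    (∀ u, (pathGraph w).Adj (w i) u → P u) ↔
      (∀ _ : 0 < (i : ℕ), P (w ⟨(i : ℕ) - 1, by have := i.isLt; omega⟩)) ∧
      (∀ h : (i : ℕ) + 1 < n, P (w ⟨(i : ℕ) + 1, h⟩)) := by
  simp only [pathGraph, SimpleGraph.fromRel_adj]
  constructor
  · intro h
    refine ⟨fun h0 => h _ ⟨?_, Or.inr ⟨(i : ℕ) - 1, by omega, rfl, ?_⟩⟩,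
      fun h1 => h _ ⟨?_, Or.inl ⟨i, h1, rfl, rfl⟩⟩⟩
    · rw [Ne, w.apply_eq_iff_eq, Fin.ext_iff]
      dsimp only
      omega
    · congr 1
      ext
      dsimp only
      omega
    · rw [Ne, w.apply_eq_iff_eq, Fin.ext_iff]
      dsimp only
      omega
  · rintro ⟨hl, hr⟩ u ⟨_, ⟨j, hj, hi, rfl⟩ | ⟨j, hj, rfl, hi⟩⟩
    · obtain rfl := w.injective hi
      exact hr hj
    · obtain rfl := w.injective hi
      exact hl (Nat.succ_pos j)

/-- If the number of local minima of `w` differs from the number of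
local maxima of `w`, then the CQF of `P_w` is not palindromic, hence not symmetric. -/
theorem stmt5 (n : ℕ) (w : Equiv.Perm (Fin n))
    (h : Nat.card {i : Fin n // LocalMinAt w i} ≠ Nat.card {i : Fin n // LocalMaxAt w i}) :
    ¬ cqfPalindromic (pathGraph w) ∧ ¬ cqfSymmetric (pathGraph w) := by
  have key : ¬ cqfPalindromic (pathGraph w) := by
    intro hpal
    apply h
    have hmin := Nat.card_congr (w.subtypeEquiv (p := LocalMinAt w)
      (q := fun v => ∀ u, (pathGraph w).Adj v u → v < u)
      fun i => (pathGraph_forall_adj_iff w i (w i < ·)).symm)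
    have hmax := Nat.card_congr (w.subtypeEquiv (p := LocalMaxAt w)
      (q := fun v => ∀ u, (pathGraph w).Adj v u → u < v)
      fun i => (pathGraph_forall_adj_iff w i (· < w i)).symm)
    rw [hmin, hmax]
    exact hpal.card_min_eq_card_max
  exact ⟨key, fun hsym => key hsym.cqfPalindromic⟩
end
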